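/- arXiv:1101.1171 — 16 statements merged into one kernel-verified Lean document; each statement's English description precedes it below -/
import Mathlib

section
/- Let X and Y be real vector spaces and let r, s be nonzero real numbers with r + s = 1. If f : X → Y is an odd function (f(−x) = −f(x) for all x ∈ X) satisfying f(rx + sy) = r·f(x) + s·f(y) − r·s·f(x − y) for all x, y ∈ X, and if r is a rational number, then f(x) = 0 for all x ∈ X. -/
/-- If `f (r • x + s • y)` is the sum of a function of `x`, a function of `y` and a function of
`x - y`, then all third differences of `f` vanish. -/
theorem third_difference_eq_zero {K X Y : Type*} [Field K] [AddCommGroup X] [Module K X]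
    [AddCommGroup Y] {r s : K} (hr : r ≠ 0) (hs : s ≠ 0) (hrs : r + s = 1)
    {f p q g : X → Y} (h : ∀ x y : X, f (r • x + s • y) = p x + q y + g (x - y)) (z a b c : X) :
    f (z + a + b + c) - f (z + a + b) - f (z + a + c) - f (z + b + c)
      + f (z + a) + f (z + b) + f (z + c) - f z = 0 := by
  have key : ∀ w b c : X, f (w + b + c)
      = p (w + r⁻¹ • b) + q (w + s⁻¹ • c) + g (r⁻¹ • b - s⁻¹ • c) := by
    intro w b c
    have e := h (w + r⁻¹ • b) (w + s⁻¹ • c)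
    rw [add_sub_add_left_eq_sub, smul_add, smul_add, smul_inv_smul₀ hr, smul_inv_smul₀ hs,
      add_add_add_comm, ← add_smul, hrs, one_smul, ← add_assoc] at e
    exact e
  have h₁ := key (z + a) b c
  have h₂ := key (z + a) b 0
  have h₃ := key (z + a) 0 c
  have h₄ := key (z + a) 0 0
  have h₅ := key z b c
  have h₆ := key z b 0
  have h₇ := key z 0 c
  have h₈ := key z 0 0
  simp only [smul_zero, add_zero] at h₂ h₃ h₄ h₆ h₇ h₈
  rw [h₁, h₂, h₃, h₄, h₅, h₆, h₇, h₈]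
  abel

/-- An odd function whose third differences vanish is additive. -/
theorem map_add_of_odd_of_third_difference_eq_zero {X Y : Type*} [AddCommGroup X]
    [AddCommGroup Y] [IsAddTorsionFree Y] {f : X → Y} (hodd : ∀ x, f (-x) = -f x)
    (h : ∀ z a b c : X, f (z + a + b + c) - f (z + a + b) - f (z + a + c) - f (z + b + c)
      + f (z + a) + f (z + b) + f (z + c) - f z = 0) (a b : X) :
    f (a + b) = f a + f b := by
  have h0 : f 0 = 0 := self_eq_neg.mp (by simpa using hodd 0)
  have e := h (-(a + b)) a b (a + b)
  rw [show -(a + b) + a + b + (a + b) = a + b by abel, show -(a + b) + a + b = 0 by abel,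
    show -(a + b) + a + (a + b) = a by abel, show -(a + b) + b + (a + b) = b by abel,
    show -(a + b) + a = -b by abel, show -(a + b) + b = -a by abel, neg_add_cancel,
    hodd, hodd, hodd, h0] at e
  rw [← sub_eq_zero, ← self_eq_neg, ← sub_eq_zero, ← e]
  abel

theorem stmt_0 {X Y : Type*} [AddCommGroup X] [Module ℝ X]
    [AddCommGroup Y] [Module ℝ Y]
    (r s : ℝ) (hr : r ≠ 0) (hs : s ≠ 0) (hrs : r + s = 1)
    (hrat : ∃ ρ : ℚ, (ρ : ℝ) = r)
    (f : X → Y) (hodd : ∀ x : X, f (-x) = -f x)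
    (hGq : ∀ x y : X,
      f (r • x + s • y) = r • f x + s • f y - (r * s) • f (x - y)) :
    ∀ x : X, f x = 0 := by
  intro x
  have : IsAddTorsionFree Y := .of_isTorsionFree ℝ Y
  have hadd := map_add_of_odd_of_third_difference_eq_zero hodd <|
    third_difference_eq_zero hr hs hrs (p := fun x ↦ r • f x) (q := fun y ↦ s • f y)
      (g := fun u ↦ -((r * s) • f u)) fun x y ↦ by rw [hGq, sub_eq_add_neg]
  have h0 : f 0 = 0 := by simpa using hadd 0 0
  have hlin : f (r • x) = r • f x := by
    obtain ⟨ρ, rfl⟩ := hrat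
    exact map_ratCast_smul (AddMonoidHom.mk' f hadd) ℝ ℝ ρ x
  have hquad := hGq x 0
  rw [smul_zero, add_zero, sub_zero, h0, smul_zero, add_zero, hlin, eq_comm, sub_eq_self] at hquad
  exact (smul_eq_zero.mp hquad).resolve_left (mul_ne_zero hr hs)
end

section
/- Let X and Y be real vector spaces and let r, s be nonzero real numbers with r + s = 1. If f : X → Y is an even function (f(−x) = f(x) for all x ∈ X) satisfying f(rx + sy) = r·f(x) + s·f(y) − r·s·f(x − y) for all x, y ∈ X, then f satisfies the quadratic functional equation f(x + y) + f(x − y) = 2·f(x) + 2·f(y) for all x, y ∈ X. -/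
theorem stmt_1 {X Y : Type*} [AddCommGroup X] [Module ℝ X]
    [AddCommGroup Y] [Module ℝ Y]
    (r s : ℝ) (hr : r ≠ 0) (hs : s ≠ 0) (hrs : r + s = 1)
    (f : X → Y) (heven : ∀ x : X, f (-x) = f x)
    (hGq : ∀ x y : X,
      f (r • x + s • y) = r • f x + s • f y - (r * s) • f (x - y)) :
    ∀ x y : X, f (x + y) + f (x - y) = (2 : ℝ) • f x + (2 : ℝ) • f y := by
  obtain rfl : s = 1 - r := by linarith
  have add_r_smul (u z : X) :
      f (u + r • z) = (1 - r) • f u + r • f (u + z) - (r * (1 - r)) • f z := by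
    have h := hGq (u + z) u
    rw [show r • (u + z) + (1 - r) • u = u + r • z by module, add_sub_cancel_left] at h
    rw [h]
    module
  have add_s_smul (u z : X) :
      f (u + (1 - r) • z) = r • f u + (1 - r) • f (u + z) - (r * (1 - r)) • f z := by
    have h := hGq u (u + z)
    rwa [show r • u + (1 - r) • (u + z) = u + (1 - r) • z by module, sub_add_cancel_left,
      heven] at h
  intro x y
  have h₁ := add_r_smul (x - y) y
  have h₂ := add_r_smul x y
  have h₃ := add_s_smul (x - y + r • y) y
  rw [show x - y + r • y + (1 - r) • y = x by module,
    show x - y + r • y + y = x + r • y by module, h₁, h₂, sub_add_cancel] at h₃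
  apply smul_right_injective Y (mul_ne_zero hr hs)
  dsimp only
  linear_combination (norm := module) -h₃
end

section
/- Let X and Y be real vector spaces, let r be a nonzero rational number with r ≠ 1, and set s = 1 − r. A function f : X → Y satisfies f(rx + sy) = r·f(x) + s·f(y) − r·s·f(x − y) for all x, y ∈ X if and only if f satisfies the quadratic functional equation f(x + y) + f(x − y) = 2·f(x) + 2·f(y) for all x, y ∈ X. -/
/-- If the second difference of `f` does not depend on the base point and `f` scales by `r ^ 2`
under some rational `r ≠ 0, 1`, then `f` is even. -/
theorem even_of_second_difference_const {X Y : Type*} [AddCommGroup X] [Module ℝ X]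
    [AddCommGroup Y] [Module ℝ Y] {r : ℚ} (hr : r ≠ 0) (hr1 : r ≠ 1) {f : X → Y} (h0 : f 0 = 0)
    (hd : ∀ y k h, f (y + k + h) - f (y + k) - f (y + h) + f y = f (k + h) - f k - f h)
    (hsmul : ∀ x, f ((r : ℝ) • x) = ((r : ℝ) ^ 2) • f x) (x : X) : f (-x) = f x := by
  let A : X →+ Y := AddMonoidHom.mk' (fun x => f x - f (-x)) fun k h => by
    have e := hd (-(k + h)) k h
    rw [show -(k + h) + k + h = 0 by abel, show -(k + h) + k = -h by abel,
      show -(k + h) + h = -k by abel, h0] at e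
    linear_combination (norm := module) -e
  have hA : (r : ℝ) • (f x - f (-x)) = ((r : ℝ) ^ 2) • (f x - f (-x)) := by
    have e : f ((r : ℝ) • x) - f (-((r : ℝ) • x)) = (r : ℝ) • (f x - f (-x)) :=
      map_ratCast_smul A ℝ ℝ r x
    rw [← e, ← smul_neg, hsmul, hsmul, smul_sub]
  have hc : (r : ℝ) * (1 - r) ≠ 0 :=
    mul_ne_zero (by exact_mod_cast hr) (sub_ne_zero.mpr (by exact_mod_cast hr1.symm))
  have hz : ((r : ℝ) * (1 - r)) • (f x - f (-x)) = 0 := by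
    linear_combination (norm := module) hA
  exact (sub_eq_zero.mp ((smul_eq_zero.mp hz).resolve_left hc)).symm

/-- The second difference of a solution of the `r`-weighted equation does not depend on the base
point. -/
theorem second_difference_const_of_weighted {X Y : Type*} [AddCommGroup X] [Module ℝ X]
    [AddCommGroup Y] [Module ℝ Y] {r : ℝ} (hr : r ≠ 0) (hr1 : r ≠ 1) {f : X → Y} (h0 : f 0 = 0)
    (hf : ∀ x y, f (r • x + (1 - r) • y) =
      r • f x + (1 - r) • f y - (r * (1 - r)) • f (x - y)) (y k h : X) :
    f (y + k + h) - f (y + k) - f (y + h) + f y = f (k + h) - f k - f h := by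
  have key : ∀ y u, (1 - r) • (f (y + k + r • u) - f (y + k) - f (y + r • u) + f y) =
      (r * (1 - r)) • (f (-u - k) - f (-u) - f (-k)) := by
    intro y u
    have e1 := hf (y + r • u - u) (y + r • u)
    have e2 := hf y (y + k)
    have e3 := hf (y + r • u - u) (y + k + r • u)
    rw [show r • (y + r • u - u) + (1 - r) • (y + r • u) = y by module,
      show y + r • u - u - (y + r • u) = -u by abel] at e1
    rw [show y - (y + k) = -k by abel] at e2
    rw [show r • (y + r • u - u) + (1 - r) • (y + k + r • u) = r • y + (1 - r) • (y + k) by module,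
      show y + r • u - u - (y + k + r • u) = -u - k by abel] at e3
    linear_combination (norm := module) e1 + e2 - e3
  have e := (key y (r⁻¹ • h)).trans (key 0 (r⁻¹ • h)).symm
  rw [smul_inv_smul₀ hr] at e
  have e' := smul_right_injective Y (sub_ne_zero.mpr hr1.symm) e
  simpa [h0] using e'

/-- The second difference of a quadratic function does not depend on the base point. -/
theorem second_difference_const_of_quadratic {X Y : Type*} [AddCommGroup X]
    [AddCommGroup Y] [Module ℝ Y] {f : X → Y}
    (hf : ∀ x y, f (x + y) + f (x - y) = (2 : ℝ) • f x + (2 : ℝ) • f y) (y k h : X) :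
    f (y + k + h) - f (y + k) - f (y + h) + f y = f (k + h) - f k - f h := by
  have e1 := hf (y + k) h
  have e2 := hf (y - h) k
  have e3 := hf y (k + h)
  have e4 := hf y h
  rw [show y - h + k = y + k - h by abel, show y - h - k = y - (k + h) by abel] at e2
  rw [← add_assoc] at e3
  have e : (2 : ℝ) • (f (y + k + h) - f (y + k) - f (y + h) + f y) =
      (2 : ℝ) • (f (k + h) - f k - f h) := by
    linear_combination (norm := module) e1 - e2 + e3 - (2 : ℝ) • e4
  exact smul_right_injective Y two_ne_zero e

theorem stmt_2 {X Y : Type*} [AddCommGroup X] [Module ℝ X]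
    [AddCommGroup Y] [Module ℝ Y]
    (r : ℚ) (hr : r ≠ 0) (hr1 : r ≠ 1)
    (f : X → Y) :
    (∀ x y : X,
      f ((r : ℝ) • x + (1 - (r : ℝ)) • y) =
        (r : ℝ) • f x + (1 - (r : ℝ)) • f y - ((r : ℝ) * (1 - (r : ℝ))) • f (x - y)) ↔
    (∀ x y : X, f (x + y) + f (x - y) = (2 : ℝ) • f x + (2 : ℝ) • f y) := by
  have hr' : (r : ℝ) ≠ 0 := by exact_mod_cast hr
  have hr1' : (r : ℝ) ≠ 1 := by exact_mod_cast hr1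
  constructor
  · intro hf
    have h0 : f 0 = 0 := by
      have e := hf 0 0
      simp only [smul_zero, add_zero, sub_zero] at e
      have hz : ((r : ℝ) * (1 - r)) • f 0 = 0 := by linear_combination (norm := module) e
      exact (smul_eq_zero.mp hz).resolve_left (mul_ne_zero hr' (sub_ne_zero.mpr hr1'.symm))
    have hsmul : ∀ x, f ((r : ℝ) • x) = ((r : ℝ) ^ 2) • f x := by
      intro x
      have e := hf x 0
      simp only [smul_zero, add_zero, sub_zero, h0] at e
      rw [e]
      module
    have hd := second_difference_const_of_weighted hr' hr1' h0 hf
    intro x y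
    have e := hd (-y) y x
    rw [neg_add_cancel, zero_add, h0, even_of_second_difference_const hr hr1 h0 hd hsmul y,
      show -y + x = x - y by abel, add_comm y x] at e
    linear_combination (norm := module) -e
  · intro hf
    have hd := second_difference_const_of_quadratic hf
    have h0 : f 0 = 0 := by
      have e := hf 0 0
      simp only [add_zero, sub_zero] at e
      have hz : (2 : ℝ) • f 0 = 0 := by linear_combination (norm := module) -e
      exact (smul_eq_zero.mp hz).resolve_left two_ne_zero
    let B (y : X) : X →+ Y := AddMonoidHom.mk' (fun x => f (y + x) - f y - f x) fun k h => by
      have e := hd y k h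
      rw [← add_assoc]
      linear_combination (norm := module) e
    have hB : ∀ y x, f (y + (r : ℝ) • x) - f y - f ((r : ℝ) • x) =
        (r : ℝ) • (f (y + x) - f y - f x) := fun y x => map_ratCast_smul (B y) ℝ ℝ r x
    have hdouble : ∀ x, f (x + x) = (4 : ℝ) • f x := by
      intro x
      have e := hf x x
      rw [sub_self, h0] at e
      linear_combination (norm := module) e
    have hsmul : ∀ x, f ((r : ℝ) • x) = ((r : ℝ) ^ 2) • f x := by
      intro x
      have e1 := hB ((r : ℝ) • x) x
      have e2 := hB x x
      rw [hdouble] at e1 e2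
      rw [add_comm ((r : ℝ) • x) x] at e1
      have e : (2 : ℝ) • f ((r : ℝ) • x) = (2 : ℝ) • ((r : ℝ) ^ 2) • f x := by
        linear_combination (norm := module) e1 + (r : ℝ) • e2
      exact smul_right_injective Y two_ne_zero e
    intro x y
    have e := hB y (x - y)
    rw [hsmul, add_sub_cancel] at e
    rw [show (r : ℝ) • x + (1 - (r : ℝ)) • y = y + (r : ℝ) • (x - y) by module]
    linear_combination (norm := module) e
end

section
/- Let X be a real normed linear space. The norm of X arises from an inner product (equivalently, the parallelogram law ‖x + y‖² + ‖x − y‖² = 2‖x‖² + 2‖y‖² holds for all x, y ∈ X) if and only if there exists a real number r with 0 < r < 1 such that, with s = 1 − r, the identity ‖rx + sy‖² + r·s·‖x − y‖² = r·‖x‖² + s·‖y‖² holds for all x, y ∈ X. -/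
theorem stmt_3 {X : Type*} [NormedAddCommGroup X] [NormedSpace ℝ X] :
    (∀ x y : X, ‖x + y‖ ^ 2 + ‖x - y‖ ^ 2 = 2 * ‖x‖ ^ 2 + 2 * ‖y‖ ^ 2) ↔
    (∃ r : ℝ, 0 < r ∧ r < 1 ∧ ∀ x y : X,
      ‖r • x + (1 - r) • y‖ ^ 2 + r * (1 - r) * ‖x - y‖ ^ 2 =
        r * ‖x‖ ^ 2 + (1 - r) * ‖y‖ ^ 2) := by
  constructor
  · intro h
    refine ⟨1 / 2, by norm_num, by norm_num, fun x y => ?_⟩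
    have hmid : (1 / 2 : ℝ) • x + (1 - 1 / 2 : ℝ) • y = (1 / 2 : ℝ) • (x + y) := by module
    rw [hmid, norm_smul, mul_pow, Real.norm_of_nonneg (by norm_num)]
    linarith [h x y]
  · rintro ⟨r, hr0, hr1, h⟩ u v
    -- `u` is the `r`-combination of `u - (1 - r) • v` and `u + r • v`, which are themselves
    -- `r`-combinations of `u`, `u - v` and of `u + v`, `u`.
    have h₁ := h u (u - v)
    have h₂ := h (u + v) u
    have h₃ := h (u - (1 - r) • v) (u + r • v)
    rw [show r • u + (1 - r) • (u - v) = u - (1 - r) • v by module, sub_sub_cancel] at h₁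
    rw [show r • (u + v) + (1 - r) • u = u + r • v by module, add_sub_cancel_left] at h₂
    rw [show r • (u - (1 - r) • v) + (1 - r) • (u + r • v) = u by module,
      show u - (1 - r) • v - (u + r • v) = -v by module, norm_neg] at h₃
    have hrs : r * (1 - r) ≠ 0 := (mul_pos hr0 (sub_pos.2 hr1)).ne'
    apply mul_left_cancel₀ hrs
    linear_combination -r * h₁ - (1 - r) * h₂ - h₃
end

section
/- Let X be a real normed linear space containing a vector of norm 1 (e.g. a nontrivial normed space), let p, q, u, v be nonzero real numbers, let r be a real number with 0 < r < 1, and set s = 1 − r. If ‖rx + sy‖^p + r·s·‖x − y‖^q = r·‖x‖^u + s·‖y‖^v holds for all x, y ∈ X, then p = q = u = v = 2. -/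
theorem stmt_4 {X : Type*} [NormedAddCommGroup X] [NormedSpace ℝ X]
    (hX : ∃ x : X, ‖x‖ = 1)
    (p q u v : ℝ) (hp : p ≠ 0) (hq : q ≠ 0) (hu : u ≠ 0) (hv : v ≠ 0)
    (r : ℝ) (hr0 : 0 < r) (hr1 : r < 1)
    (h : ∀ x y : X,
      ‖r • x + (1 - r) • y‖ ^ p + r * (1 - r) * ‖x - y‖ ^ q =
        r * ‖x‖ ^ u + (1 - r) * ‖y‖ ^ v) :
    p = 2 ∧ q = 2 ∧ u = 2 ∧ v = 2 := by
  obtain ⟨e, he⟩ := hX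
  have hs0 : 0 < 1 - r := by linarith
  have scalar (a b : ℝ) : |r * a + (1 - r) * b| ^ p + r * (1 - r) * |a - b| ^ q =
      r * |a| ^ u + (1 - r) * |b| ^ v := by
    have hab := h (a • e) (b • e)
    simpa only [smul_smul, ← add_smul, ← sub_smul, norm_smul, he, mul_one,
      Real.norm_eq_abs] using hab
  have p_eq : p = 2 := by
    have h10 := scalar 1 0
    simp only [mul_one, mul_zero, add_zero, sub_zero, abs_one, abs_zero, Real.one_rpow,
      Real.zero_rpow hv, abs_of_pos hr0] at h10
    have hpow : r ^ p = r ^ (2 : ℝ) := by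
      rw [Real.rpow_two]
      linarith
    exact (Real.rpow_right_inj hr0 hr1.ne).mp hpow
  subst p_eq
  have eq_two {w : ℝ} (hw : (2 : ℝ) ^ w = 4) : w = 2 := by
    refine (Real.rpow_right_inj (x := 2) (by norm_num) (by norm_num)).mp ?_
    rw [hw, Real.rpow_two]
    norm_num
  have h22 := scalar 2 2
  have h20 := scalar 2 0
  have h02 := scalar 0 2
  simp only [Real.rpow_two, sq_abs, mul_zero, add_zero, zero_add, sub_zero, zero_sub, sub_self,
    abs_neg, abs_zero, abs_two, Real.zero_rpow hq, Real.zero_rpow hu,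
    Real.zero_rpow hv] at h22 h20 h02
  have hq4 : (2 : ℝ) ^ q = 4 := by
    have hrs : r * (1 - r) ≠ 0 := (mul_pos hr0 hs0).ne'
    apply mul_left_cancel₀ hrs
    linarith
  rw [hq4] at h20 h02
  refine ⟨rfl, eq_two hq4, eq_two ?_, eq_two ?_⟩
  · apply mul_left_cancel₀ hr0.ne'
    linarith
  · apply mul_left_cancel₀ hs0.ne'
    linarith
end

section
/- Let X be a nontrivial real normed linear space. The norm of X arises from an inner product (equivalently, the parallelogram law ‖x + y‖² + ‖x − y‖² = 2‖x‖² + 2‖y‖² holds for all x, y ∈ X) if and only if there exist a real number r with 0 < r < 1 and nonzero real numbers p, q, u, v such that, with s = 1 − r, the identity ‖rx + sy‖^p + r·s·‖x − y‖^q = r·‖x‖^u + s·‖y‖^v holds for all x, y ∈ X. -/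
/-- If the norm satisfies the quadratic identity with a single weight `0 < r < 1`, it satisfies the
parallelogram law. -/
theorem parallelogram_of_weighted {X : Type*} [NormedAddCommGroup X] [NormedSpace ℝ X] {r : ℝ}
    (hr0 : 0 < r) (hr1 : r < 1)
    (h : ∀ x y : X, ‖r • x + (1 - r) • y‖ ^ 2 + r * (1 - r) * ‖x - y‖ ^ 2 =
      r * ‖x‖ ^ 2 + (1 - r) * ‖y‖ ^ 2) (x y : X) :
    ‖x + y‖ ^ 2 + ‖x - y‖ ^ 2 = 2 * ‖x‖ ^ 2 + 2 * ‖y‖ ^ 2 := by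
  have h₁ := h (x + (1 - r) • y) (x - r • y)
  have h₂ := h (x - y) x
  have h₃ := h x (x + y)
  rw [show r • (x + (1 - r) • y) + (1 - r) • (x - r • y) = x by module,
    show x + (1 - r) • y - (x - r • y) = y by module] at h₁
  rw [show r • (x - y) + (1 - r) • x = x - r • y by module,
    show x - y - x = -y by module, norm_neg] at h₂
  rw [show r • x + (1 - r) • (x + y) = x + (1 - r) • y by module,
    show x - (x + y) = -y by module, norm_neg] at h₃
  have hrs : r * (1 - r) ≠ 0 := (mul_pos hr0 (sub_pos.2 hr1)).ne'
  apply mul_left_cancel₀ hrs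
  linear_combination -h₁ - (1 - r) * h₂ - r * h₃

/-- The weighted identity with arbitrary nonzero exponents forces all exponents to equal `2`. -/
theorem exponents_eq_two_of_weighted {X : Type*} [NormedAddCommGroup X] [NormedSpace ℝ X]
    [Nontrivial X] {r p q u v : ℝ} (hr0 : 0 < r) (hr1 : r < 1)
    (hq : q ≠ 0) (hu : u ≠ 0) (hv : v ≠ 0)
    (h : ∀ x y : X, ‖r • x + (1 - r) • y‖ ^ p + r * (1 - r) * ‖x - y‖ ^ q =
      r * ‖x‖ ^ u + (1 - r) * ‖y‖ ^ v) :
    p = 2 ∧ q = 2 ∧ u = 2 ∧ v = 2 := by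
  have hs0 : 0 < 1 - r := sub_pos.2 hr1
  have two_of {a : ℝ} (ha : (2 : ℝ) ^ a = 4) : a = 2 := by
    apply (Real.rpow_right_inj (x := 2) (by norm_num) (by norm_num)).1
    rw [ha]; norm_num
  obtain ⟨e, he⟩ := exists_norm_eq X (zero_le_one' ℝ)
  have h₁ := h e 0
  simp only [smul_zero, add_zero, norm_smul, Real.norm_eq_abs, abs_of_pos hr0, he, sub_zero,
    norm_zero, Real.zero_rpow hv, Real.one_rpow, mul_one, mul_zero] at h₁
  have hp2 : p = 2 := by
    apply (Real.rpow_right_inj hr0 hr1.ne).1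
    rw [Real.rpow_two]
    linear_combination h₁
  subst hp2
  have norm_two : ‖(2 : ℝ) • e‖ = 2 := by simp [norm_smul, he]
  have hx := h ((2 : ℝ) • e) 0
  have hy := h 0 ((2 : ℝ) • e)
  have hd := h ((2 : ℝ) • e) ((2 : ℝ) • e)
  rw [← add_smul, add_sub_cancel, one_smul, sub_self, norm_zero, Real.zero_rpow hq, norm_two,
    Real.rpow_two] at hd
  rw [smul_zero, add_zero, norm_smul, sub_zero, norm_zero, Real.zero_rpow hv, norm_two,
    Real.norm_eq_abs, abs_of_pos hr0, Real.rpow_two] at hx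
  rw [smul_zero, zero_add, norm_smul, zero_sub, norm_neg, norm_zero, Real.zero_rpow hu, norm_two,
    Real.norm_eq_abs, abs_of_pos hs0, Real.rpow_two] at hy
  have hq4 : (2 : ℝ) ^ q = 4 := by
    apply mul_left_cancel₀ (mul_pos hr0 hs0).ne'
    linear_combination (hx + hy - hd) / 2
  rw [hq4] at hx hy
  refine ⟨rfl, two_of hq4, two_of ?_, two_of ?_⟩
  · apply mul_left_cancel₀ hr0.ne'
    linear_combination -hx
  · apply mul_left_cancel₀ hs0.ne'
    linear_combination -hy

theorem stmt_5 {X : Type*} [NormedAddCommGroup X] [NormedSpace ℝ X]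
    [Nontrivial X] :
    (∀ x y : X, ‖x + y‖ ^ 2 + ‖x - y‖ ^ 2 = 2 * ‖x‖ ^ 2 + 2 * ‖y‖ ^ 2) ↔
    (∃ r p q u v : ℝ, 0 < r ∧ r < 1 ∧ p ≠ 0 ∧ q ≠ 0 ∧ u ≠ 0 ∧ v ≠ 0 ∧
      ∀ x y : X,
        ‖r • x + (1 - r) • y‖ ^ p + r * (1 - r) * ‖x - y‖ ^ q =
          r * ‖x‖ ^ u + (1 - r) * ‖y‖ ^ v) := by
  constructor
  · intro h
    refine ⟨1 / 2, 2, 2, 2, 2, by norm_num, by norm_num, by norm_num, by norm_num, by norm_num,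
      by norm_num, fun x y => ?_⟩
    have hmid : ‖(1 / 2 : ℝ) • x + (1 - 1 / 2 : ℝ) • y‖ = 1 / 2 * ‖x + y‖ := by
      rw [show (1 / 2 : ℝ) • x + (1 - 1 / 2 : ℝ) • y = (1 / 2 : ℝ) • (x + y) by module, norm_smul]
      norm_num
    simp only [hmid, Real.rpow_two]
    linear_combination h x y / 4
  · rintro ⟨r, p, q, u, v, hr0, hr1, -, hq, hu, hv, h⟩
    obtain ⟨rfl, rfl, rfl, rfl⟩ := exponents_eq_two_of_weighted hr0 hr1 hq hu hv h
    simp only [Real.rpow_two] at h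
    exact parallelogram_of_weighted hr0 hr1 h
end

section
/- Let X and Y be real normed spaces, let r, s be nonzero real numbers with r + s = 1, and let d > 0 and δ ≥ 0 be given. Assume that an even mapping f : X → Y satisfies ‖f(rx + sy) + r·s·f(x − y) − r·f(x) − s·f(y)‖ ≤ δ for all x, y ∈ X with ‖x‖ + ‖y‖ ≥ d. Then there exists K > 0 such that ‖f(x + y) + f(x − y) − 2·f(x) − 2·f(y)‖ ≤ (4(2 + |r| + |s|)/|r·s|)·δ for all x, y ∈ X with ‖x‖ + ‖y‖ ≥ K. -/
/-- The bound on the quadratic difference at a pair `(x, y)` whose first entry is large. -/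
theorem norm_quadratic_difference_le {X Y : Type*} [NormedAddCommGroup X] [NormedSpace ℝ X]
    [NormedAddCommGroup Y] [NormedSpace ℝ Y]
    {r s d δ : ℝ} (hr : r ≠ 0) (hs : s ≠ 0) (hrs : r + s = 1) {f : X → Y}
    (heven : ∀ x : X, f (-x) = f x)
    (h : ∀ x y : X, d ≤ ‖x‖ + ‖y‖ →
      ‖f (r • x + s • y) + (r * s) • f (x - y) - r • f x - s • f y‖ ≤ δ)
    {x : X} (y : X) (hx : d ≤ ‖x‖) (hrx : d ≤ ‖r • x‖) :
    ‖f (x + y) + f (x - y) - (2 : ℝ) • f x - (2 : ℝ) • f y‖ ≤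
      (3 + |r| + |s|) / |r * s| * δ := by
  obtain rfl : s = 1 - r := by linarith
  have norm_le_add (z : X) : ‖x‖ ≤ ‖z + x‖ + ‖z‖ := by
    simpa using norm_sub_le (z + x) z
  have norm_le_sub (z : X) : ‖x‖ ≤ ‖z - x‖ + ‖z‖ := by
    simpa [norm_sub_rev, add_comm] using norm_sub_le z (z - x)
  have h₁ := h x y (by linarith [norm_nonneg y])
  have h₂ := h x (-y) (by linarith [norm_nonneg (-y)])
  have h₃ := h (r • x) (r • x + y) (by linarith [norm_nonneg (r • x + y)])
  have h₄ := h (r • x) (r • x - y) (by linarith [norm_nonneg (r • x - y)])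
  have h₅ := h (y + x) y (hx.trans (norm_le_add y))
  have h₆ := h (y - x) y (hx.trans (norm_le_sub y))
  have h₇ := h x 0 (by simpa using hx)
  have h₈ := h x x (by linarith [norm_nonneg x])
  rw [show r • x + (1 - r) • -y = r • x - (1 - r) • y by module, sub_neg_eq_add, heven] at h₂
  rw [show r • r • x + (1 - r) • (r • x + y) = r • x + (1 - r) • y by module,
    show r • x - (r • x + y) = -y by module, heven] at h₃
  rw [show r • r • x + (1 - r) • (r • x - y) = r • x - (1 - r) • y by module,
    show r • x - (r • x - y) = y by module] at h₄
  rw [show r • (y + x) + (1 - r) • y = r • x + y by module,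
    add_sub_cancel_left, add_comm y x] at h₅
  rw [show r • (y - x) + (1 - r) • y = -(r • x - y) by module, heven,
    show y - x - y = -x by module, heven, ← neg_sub x y, heven] at h₆
  rw [smul_zero, add_zero, sub_zero] at h₇
  rw [show r • x + (1 - r) • x = x by module, sub_self] at h₈
  set D₁ := f (r • x + (1 - r) • y) + (r * (1 - r)) • f (x - y) - r • f x - (1 - r) • f y
    with hD₁
  set D₂ := f (r • x - (1 - r) • y) + (r * (1 - r)) • f (x + y) - r • f x - (1 - r) • f y
    with hD₂
  set D₃ := f (r • x + (1 - r) • y) + (r * (1 - r)) • f y - r • f (r • x)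
    - (1 - r) • f (r • x + y) with hD₃
  set D₄ := f (r • x - (1 - r) • y) + (r * (1 - r)) • f y - r • f (r • x)
    - (1 - r) • f (r • x - y) with hD₄
  set D₅ := f (r • x + y) + (r * (1 - r)) • f x - r • f (x + y) - (1 - r) • f y with hD₅
  set D₆ := f (r • x - y) + (r * (1 - r)) • f x - r • f (x - y) - (1 - r) • f y with hD₆
  set D₇ := f (r • x) + (r * (1 - r)) • f x - r • f x - (1 - r) • f 0 with hD₇
  set D₈ := f x + (r * (1 - r)) • f 0 - r • f x - (1 - r) • f x with hD₈
  set Q := f (x + y) + f (x - y) - (2 : ℝ) • f x - (2 : ℝ) • f y with hQ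
  have key : (2 * (r * (1 - r))) • Q = (D₁ + D₂) - (D₃ + D₄) - (1 - r) • (D₅ + D₆)
      - (2 * r) • D₇ - (2 : ℝ) • D₈ := by
    rw [hD₁, hD₂, hD₃, hD₄, hD₅, hD₆, hD₇, hD₈, hQ]
    module
  have hbound : 2 * |r * (1 - r)| * ‖Q‖ ≤ 2 * (3 + |r| + |1 - r|) * δ := by
    calc 2 * |r * (1 - r)| * ‖Q‖ = ‖(2 * (r * (1 - r))) • Q‖ := by
          rw [norm_smul, Real.norm_eq_abs, abs_mul 2, abs_two]
      _ ≤ ((δ + δ) + (δ + δ)) + |1 - r| * (δ + δ) + (2 * |r|) * δ + 2 * δ := by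
          rw [key]
          refine norm_sub_le_of_le (norm_sub_le_of_le (norm_sub_le_of_le (norm_sub_le_of_le
            (norm_add_le_of_le h₁ h₂) (norm_add_le_of_le h₃ h₄)) ?_) ?_) ?_
          · rw [norm_smul, Real.norm_eq_abs]
            gcongr
            exact norm_add_le_of_le h₅ h₆
          · rw [norm_smul, Real.norm_eq_abs, abs_mul, abs_two]
            gcongr
          · rw [norm_smul, Real.norm_two]
            gcongr
      _ = 2 * (3 + |r| + |1 - r|) * δ := by ring
  rw [div_mul_eq_mul_div, le_div_iff₀ (abs_pos.mpr (mul_ne_zero hr hs))]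
  linarith

theorem stmt_6 {X Y : Type*} [NormedAddCommGroup X] [NormedSpace ℝ X]
    [NormedAddCommGroup Y] [NormedSpace ℝ Y]
    (r s d δ : ℝ) (hr : r ≠ 0) (hs : s ≠ 0) (hrs : r + s = 1)
    (hd : 0 < d) (hδ : 0 ≤ δ)
    (f : X → Y) (heven : ∀ x : X, f (-x) = f x)
    (h : ∀ x y : X, d ≤ ‖x‖ + ‖y‖ →
      ‖f (r • x + s • y) + (r * s) • f (x - y) - r • f x - s • f y‖ ≤ δ) :
    ∃ K : ℝ, 0 < K ∧ ∀ x y : X, K ≤ ‖x‖ + ‖y‖ →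
      ‖f (x + y) + f (x - y) - (2 : ℝ) • f x - (2 : ℝ) • f y‖ ≤
        4 * (2 + |r| + |s|) / |r * s| * δ := by
  have hr' : 0 < |r| := abs_pos.mpr hr
  have hone : 1 ≤ |r| + |s| := by simpa [hrs] using abs_add_le r s
  have hlarge : ∀ x y : X, d + d / |r| ≤ ‖x‖ →
      ‖f (x + y) + f (x - y) - (2 : ℝ) • f x - (2 : ℝ) • f y‖ ≤
        4 * (2 + |r| + |s|) / |r * s| * δ := by
    intro x y hx
    have hdr : 0 < d / |r| := by positivity
    have hrx : d ≤ ‖r • x‖ := by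
      rw [norm_smul, Real.norm_eq_abs, ← div_le_iff₀' hr']
      linarith
    refine (norm_quadratic_difference_le hr hs hrs heven h y (by linarith) hrx).trans ?_
    gcongr
    linarith
  refine ⟨2 * (d + d / |r|), by positivity, fun x y hxy ↦ ?_⟩
  rcases le_total ‖y‖ ‖x‖ with hle | hle
  · exact hlarge x y (by linarith)
  · have hyx := hlarge y x (by linarith)
    rwa [add_comm y x, ← neg_sub x y, heven, sub_right_comm] at hyx
end

section
/- Let X and Y be real vector spaces and let r, s be nonzero real numbers with r + s = 1. If f : X → Y is an odd function satisfying f(rx + sy) = r·f(x) + s·f(y) − r·s·f(x − y) for all x, y ∈ X, then f(s·y) = s·(1 + r)·f(y) and f(r·x) = r²·f(x) for all x, y ∈ X. -/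
theorem stmt_11 {X Y : Type*} [AddCommGroup X] [Module ℝ X]
    [AddCommGroup Y] [Module ℝ Y]
    (r s : ℝ) (hr : r ≠ 0) (hs : s ≠ 0) (hrs : r + s = 1)
    (f : X → Y) (hodd : ∀ x : X, f (-x) = -f x)
    (hGq : ∀ x y : X,
      f (r • x + s • y) = r • f x + s • f y - (r * s) • f (x - y)) :
    (∀ y : X, f (s • y) = (s * (1 + r)) • f y) ∧
    (∀ x : X, f (r • x) = (r ^ 2) • f x) := by
  have h0 : f 0 = 0 := by
    have h := hodd 0
    rw [neg_zero, eq_neg_iff_add_eq_zero, ← two_smul ℝ] at h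
    exact (smul_eq_zero.mp h).resolve_left two_ne_zero
  obtain rfl : s = 1 - r := by linarith
  refine ⟨fun y => ?_, fun x => ?_⟩
  · have h := hGq 0 y
    rw [smul_zero, zero_add, zero_sub, hodd, h0] at h
    rw [h]
    module
  · have h := hGq x 0
    rw [smul_zero, add_zero, sub_zero, h0] at h
    rw [h]
    module
end

section
/- Let X and Y be real vector spaces and let r, s be nonzero real numbers with r + s = 1. If f : X → Y is an odd function satisfying f(rx + sy) = r·f(x) + s·f(y) − r·s·f(x − y) for all x, y ∈ X, then f satisfies the Jensen-type identity f(x + y) + f(x − y) = 2·f(x) for all x, y ∈ X, and consequently f is additive: f(x + y) = f(x) + f(y) for all x, y ∈ X. -/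
theorem stmt_12 {X Y : Type*} [AddCommGroup X] [Module ℝ X]
    [AddCommGroup Y] [Module ℝ Y]
    (r s : ℝ) (hr : r ≠ 0) (hs : s ≠ 0) (hrs : r + s = 1)
    (f : X → Y) (hodd : ∀ x : X, f (-x) = -f x)
    (hGq : ∀ x y : X,
      f (r • x + s • y) = r • f x + s • f y - (r * s) • f (x - y)) :
    (∀ x y : X, f (x + y) + f (x - y) = (2 : ℝ) • f x) ∧
    (∀ x y : X, f (x + y) = f x + f y) := by
  obtain rfl : s = 1 - r := by linarith
  have h0 : f 0 = 0 := by
    have h := hodd 0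
    rw [neg_zero] at h
    have h2 : (2 : ℝ) • f 0 = 0 := by linear_combination (norm := module) h
    simpa using h2
  have hfr (x : X) : f (r • x) = (r ^ 2) • f x := by
    have h := hGq x 0
    simp only [smul_zero, add_zero, sub_zero, h0] at h
    rw [h]; module
  have hfs (x : X) : f ((1 - r) • x) = ((1 - r) * (1 + r)) • f x := by
    have h := hGq 0 x
    simp only [smul_zero, zero_add, zero_sub, h0, hodd] at h
    rw [h]; module
  obtain ⟨D, hD⟩ : ∃ D : X → X → Y, ∀ x y, D x y = f (x + y) + f (x - y) - (2 : ℝ) • f x :=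
    ⟨_, fun _ _ => rfl⟩
  have hDr (x y : X) : D x (r • y) = r • D x y := by
    have h1 := hGq (x + y) x
    have h2 := hGq (x - y) x
    rw [show r • (x + y) + (1 - r) • x = x + r • y by module, add_sub_cancel_left] at h1
    rw [show r • (x - y) + (1 - r) • x = x - r • y by module,
      show x - y - x = -y by abel, hodd] at h2
    rw [hD, hD, h1, h2]; module
  have hDs (x y : X) : D x ((1 - r) • y) = (1 - r) • D x y := by
    have h1 := hGq x (x + y)
    have h2 := hGq x (x - y)
    rw [show r • x + (1 - r) • (x + y) = x + (1 - r) • y by module,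
      show x - (x + y) = -y by abel, hodd] at h1
    rw [show r • x + (1 - r) • (x - y) = x - (1 - r) • y by module, sub_sub_cancel] at h2
    rw [hD, hD, h1, h2]; module
  have hDr' (x y : X) : D (r • x) y = r • D x y := by
    have h : D (r • x) (r • y) = (r ^ 2) • D x y := by
      rw [hD, hD, ← smul_add, ← smul_sub]
      simp only [hfr]
      module
    rw [hDr] at h
    apply smul_right_injective Y hr
    simp only [h]
    module
  have hDs' (x y : X) : D ((1 - r) • x) y = (1 + r) • D x y := by
    have h : D ((1 - r) • x) ((1 - r) • y) = ((1 - r) * (1 + r)) • D x y := by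
      rw [hD, hD, ← smul_add, ← smul_sub]
      simp only [hfs]
      module
    rw [hDs] at h
    apply smul_right_injective Y hs
    simp only [h]
    module
  have hadd (x y : X) : D x y + D y x = (2 : ℝ) • (f (x + y) - f x - f y) := by
    have h : f (y - x) = -f (x - y) := by rw [← hodd, neg_sub]
    rw [hD, hD, add_comm y x, h]; module
  have hsub (x y : X) : D x y - D y x = (2 : ℝ) • (f (x - y) - f x + f y) := by
    have h : f (y - x) = -f (x - y) := by rw [← hodd, neg_sub]
    rw [hD, hD, add_comm y x, h]; module
  have hkey (x y : X) : (1 - r) • D x y = -(r • D y x) := by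
    have h1 := hadd (r • x) ((1 - r) • y)
    rw [hGq, hfr, hfs, hDr', hDs, hDr, hDs'] at h1
    have h2 := hsub x y
    have h3 : (2 * r) • ((1 - r) • D x y) = (2 * r) • (-(r • D y x)) := by
      linear_combination (norm := module) h1 + (r * (1 - r)) • h2
    exact smul_right_injective Y (mul_ne_zero two_ne_zero hr) h3
  have hDzero (x y : X) : D x y = 0 := by
    have h : (1 - 2 * r) • D x y = 0 := by
      linear_combination (norm := module) (1 - r) • hkey x y - r • hkey y x
    rcases smul_eq_zero.mp h with h | h
    · have hr2 : r = 1 / 2 := by linarith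
      have hf (z : X) : f z = 0 := by
        have h1 := hfr z
        have h2 := hfs z
        subst hr2
        rw [show (1 - 1 / 2 : ℝ) = 1 / 2 by norm_num, h1] at h2
        have h3 : (1 / 2 : ℝ) • f z = 0 := by linear_combination (norm := module) -h2
        simpa using h3
      simp [hD, hf]
    · exact h
  refine ⟨fun x y => ?_, fun x y => ?_⟩
  · rw [← sub_eq_zero, ← hD, hDzero]
  · have h := hadd x y
    rw [hDzero, hDzero, add_zero] at h
    have h' := (smul_eq_zero.mp h.symm).resolve_left two_ne_zero
    rwa [sub_sub, sub_eq_zero] at h'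
end

section
/- Let X and Y be real vector spaces and let r, s be nonzero real numbers with r + s = 1. If f : X → Y is an even function satisfying f(rx + sy) = r·f(x) + s·f(y) − r·s·f(x − y) for all x, y ∈ X, then f(0) = 0 and f(2x) = 4·f(x) for all x ∈ X. -/
theorem stmt_13 {X Y : Type*} [AddCommGroup X] [Module ℝ X]
    [AddCommGroup Y] [Module ℝ Y]
    (r s : ℝ) (hr : r ≠ 0) (hs : s ≠ 0) (hrs : r + s = 1)
    (f : X → Y) (heven : ∀ x : X, f (-x) = f x)
    (hGq : ∀ x y : X,
      f (r • x + s • y) = r • f x + s • f y - (r * s) • f (x - y)) :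
    f 0 = 0 ∧ ∀ x : X, f ((2 : ℝ) • x) = (4 : ℝ) • f x := by
  obtain rfl : r = 1 - s := by linarith
  have hrs0 : (1 - s) * s ≠ 0 := mul_ne_zero hr hs
  have h0 : f 0 = 0 := by
    have h := hGq 0 0
    simp only [smul_zero, add_zero, sub_zero] at h
    refine (smul_eq_zero.mp ?_).resolve_left hrs0
    linear_combination (norm := module) h
  refine ⟨h0, fun x => ?_⟩
  have hsx : f (s • x) = s ^ 2 • f x := by
    have h := hGq 0 x
    simp only [smul_zero, zero_add, zero_sub, h0, heven] at h
    rw [h]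
    module
  have hadd : f (s • x + x) = s • f ((2 : ℝ) • x) + (1 - s) ^ 2 • f x := by
    have h := hGq x ((2 : ℝ) • x)
    rw [show (1 - s) • x + s • (2 : ℝ) • x = s • x + x by module,
      show x - (2 : ℝ) • x = -x by module, heven] at h
    rw [h]
    module
  have hx := hGq (s • x + x) (s • x)
  rw [show (1 - s) • (s • x + x) + s • s • x = x by module,
    add_sub_cancel_left, hadd, hsx] at hx
  refine smul_right_injective Y hrs0 ?_
  linear_combination (norm := module) -hx
end

section
/- Let X and Y be real vector spaces and let r, s be nonzero real numbers with r + s = 1. If f : X → Y is an even function satisfying f(rx + sy) = r·f(x) + s·f(y) − r·s·f(x − y) for all x, y ∈ X, then f(2x + y) + 2·f(x) + f(y) = 2·f(x + y) + f(2x) for all x, y ∈ X. -/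
theorem stmt_14 {X Y : Type*} [AddCommGroup X] [Module ℝ X]
    [AddCommGroup Y] [Module ℝ Y]
    (r s : ℝ) (hr : r ≠ 0) (hs : s ≠ 0) (hrs : r + s = 1)
    (f : X → Y) (heven : ∀ x : X, f (-x) = f x)
    (hGq : ∀ x y : X,
      f (r • x + s • y) = r • f x + s • f y - (r * s) • f (x - y)) :
    ∀ x y : X,
      f ((2 : ℝ) • x + y) + (2 : ℝ) • f x + f y =
        (2 : ℝ) • f (x + y) + f ((2 : ℝ) • x) := by
  intro x y
  obtain ⟨w, rfl⟩ : ∃ w : X, y = s • w := ⟨s⁻¹ • y, (smul_inv_smul₀ hs y).symm⟩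
  have h0 : f 0 = 0 := by
    have h := hGq 0 0
    simp only [smul_zero, add_zero, sub_zero] at h
    have h' : (r * s) • f 0 = 0 := by
      linear_combination (norm := module) h + hrs • f 0
    exact (smul_eq_zero.mp h').resolve_left (mul_ne_zero hr hs)
  -- Third differences along directions killing every term of `hGq` except `r • f x`.
  have h₁ := hGq ((2 : ℝ) • x + s • w) (x - r • w)
  have h₂ := hGq ((2 : ℝ) • x) x
  have h₃ := hGq (x + s • w) (x - r • w)
  have h₄ := hGq x x
  have h₅ := hGq (x + s • w) (-(r • w))
  have h₆ := hGq x 0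
  have h₇ := hGq (s • w) (-(r • w))
  rw [show r • ((2 : ℝ) • x + s • w) + s • (x - r • w) = r • (2 : ℝ) • x + s • x by module,
    show (2 : ℝ) • x + s • w - (x - r • w) = x + s • w + r • w by module] at h₁
  rw [show (2 : ℝ) • x - x = x by module] at h₂
  rw [show r • (x + s • w) + s • (x - r • w) = r • x + s • x by module,
    show x + s • w - (x - r • w) = s • w + r • w by module] at h₃
  rw [sub_self, h0] at h₄
  rw [show r • (x + s • w) + s • -(r • w) = r • x by module, sub_neg_eq_add] at h₅
  rw [smul_zero, add_zero, sub_zero, h0] at h₆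
  rw [show r • s • w + s • -(r • w) = 0 by module, sub_neg_eq_add, h0] at h₇
  have key : r • (f ((2 : ℝ) • x + s • w) + (2 : ℝ) • f x + f (s • w)) =
      r • ((2 : ℝ) • f (x + s • w) + f ((2 : ℝ) • x)) := by
    linear_combination (norm := module) -h₁ + h₂ + h₃ - h₄ + h₅ - h₆ - h₇
  exact smul_right_injective Y hr key
end

section
/- Let X and Y be real vector spaces and let r, s be nonzero real numbers with r + s = 1. If f : X → Y satisfies the quadratic functional equation f(x + y) + f(x − y) = 2·f(x) + 2·f(y) for all x, y ∈ X, and if r is a rational number, then f satisfies f(rx + sy) = r·f(x) + s·f(y) − r·s·f(x − y) for all x, y ∈ X. -/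
theorem quadratic_map_zero {X Y : Type*} [AddCommGroup X] [AddCommGroup Y] [Module ℝ Y]
    {f : X → Y}
    (hq : ∀ x y : X, f (x + y) + f (x - y) = (2 : ℝ) • f x + (2 : ℝ) • f y) : f 0 = 0 := by
  have h := hq 0 0
  rw [add_zero, sub_zero, ← two_smul ℝ (f 0)] at h
  have h2 : (2 : ℝ) • f 0 = 0 := left_eq_add.mp h
  exact (smul_eq_zero.mp h2).resolve_left two_ne_zero

/-- Along an arithmetic progression, a solution of the quadratic equation is a quadratic
polynomial in the index. -/
theorem quadratic_map_add_int_smul {X Y : Type*} [AddCommGroup X] [Module ℝ X]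
    [AddCommGroup Y] [Module ℝ Y] {f : X → Y}
    (hq : ∀ x y : X, f (x + y) + f (x - y) = (2 : ℝ) • f x + (2 : ℝ) • f y) (y z : X) (n : ℤ) :
    f (y + (n : ℝ) • z) =
      f y + (n : ℝ) • (f (y + z) - f y - f z) + (n : ℝ) ^ 2 • f z := by
  have step (t : ℝ) : f (y + (t + 1) • z) + f (y + (t - 1) • z) =
      (2 : ℝ) • f (y + t • z) + (2 : ℝ) • f z := by
    rw [← hq]
    congr 2 <;> module
  suffices h : ∀ n : ℤ,
      f (y + (n : ℝ) • z) =
        f y + (n : ℝ) • (f (y + z) - f y - f z) + (n : ℝ) ^ 2 • f z ∧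
      f (y + ((n : ℝ) + 1) • z) =
        f y + ((n : ℝ) + 1) • (f (y + z) - f y - f z) + ((n : ℝ) + 1) ^ 2 • f z from (h n).1
  intro n
  induction n with
  | zero =>
    simp only [Int.cast_zero]
    constructor
    · simp
    · rw [zero_add, one_smul]
      module
  | succ n ih =>
    obtain ⟨h₀, h₁⟩ := ih
    have h := step ((n : ℝ) + 1)
    rw [add_sub_cancel_right] at h
    push_cast at h₀ h₁ ⊢
    rw [h₀, h₁] at h
    refine ⟨h₁, ?_⟩
    rw [eq_sub_of_add_eq h]
    module
  | pred n ih =>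
    obtain ⟨h₀, h₁⟩ := ih
    have h := step (-(n : ℝ))
    push_cast at h₀ h₁ ⊢
    rw [h₀, h₁] at h
    rw [sub_add_cancel]
    refine ⟨?_, h₀⟩
    rw [eq_sub_of_add_eq' h]
    module

theorem stmt_15 {X Y : Type*} [AddCommGroup X] [Module ℝ X]
    [AddCommGroup Y] [Module ℝ Y]
    (r s : ℝ) (hr : r ≠ 0) (hs : s ≠ 0) (hrs : r + s = 1)
    (hrat : ∃ ρ : ℚ, (ρ : ℝ) = r)
    (f : X → Y)
    (hq : ∀ x y : X, f (x + y) + f (x - y) = (2 : ℝ) • f x + (2 : ℝ) • f y) :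
    ∀ x y : X,
      f (r • x + s • y) = r • f x + s • f y - (r * s) • f (x - y) := by
  intro x y
  obtain ⟨ρ, rfl⟩ := hrat
  obtain rfl : s = 1 - (ρ : ℝ) := by linarith
  have hd : (ρ.den : ℝ) ≠ 0 := by exact_mod_cast ρ.den_ne_zero
  have hρ : (ρ : ℝ) * ρ.den = ρ.num := by exact_mod_cast ρ.mul_den_eq_num
  set w : X := (ρ.den : ℝ)⁻¹ • (x - y)
  have hdw : (ρ.den : ℝ) • w = x - y := smul_inv_smul₀ hd _
  have hnw : (ρ.num : ℝ) • w = (ρ : ℝ) • (x - y) := by rw [← hρ, mul_smul, hdw]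
  have hnum := quadratic_map_add_int_smul hq y w ρ.num
  have hden := quadratic_map_add_int_smul hq y w ρ.den
  have hdiff := quadratic_map_add_int_smul hq 0 w ρ.den
  rw [Int.cast_natCast, hdw] at hden hdiff
  rw [add_sub_cancel] at hden
  simp only [zero_add, quadratic_map_zero hq, sub_zero, sub_self, smul_zero] at hdiff
  have hxy : (ρ : ℝ) • x + (1 - (ρ : ℝ)) • y = y + (ρ.num : ℝ) • w := by
    rw [hnw]
    module
  rw [hxy, hnum, hden, hdiff, ← hρ]
  module
end

section
/- Let X and Y be real normed spaces, let r, s be nonzero real numbers with r + s = 1, and let d > 0 and δ ≥ 0 be given. Assume that an even mapping f : X → Y satisfies ‖f(rx + sy) + r·s·f(x − y) − r·f(x) − s·f(y)‖ ≤ δ for all x, y ∈ X with ‖x‖ + ‖y‖ ≥ d. Then ‖f(rx + y) + r·s·f(x) − r·f(x + y) − s·f(y)‖ ≤ δ for all x, y ∈ X with ‖x‖ + ‖y‖ ≥ 2d. -/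
theorem stmt_16 {X Y : Type*} [NormedAddCommGroup X] [NormedSpace ℝ X]
    [NormedAddCommGroup Y] [NormedSpace ℝ Y]
    (r s d δ : ℝ) (hr : r ≠ 0) (hs : s ≠ 0) (hrs : r + s = 1)
    (hd : 0 < d) (hδ : 0 ≤ δ)
    (f : X → Y) (heven : ∀ x : X, f (-x) = f x)
    (h : ∀ x y : X, d ≤ ‖x‖ + ‖y‖ →
      ‖f (r • x + s • y) + (r * s) • f (x - y) - r • f x - s • f y‖ ≤ δ) :
    ∀ x y : X, 2 * d ≤ ‖x‖ + ‖y‖ →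
      ‖f (r • x + y) + (r * s) • f x - r • f (x + y) - s • f y‖ ≤ δ := by
  intro x y hxy
  have hx : ‖x‖ ≤ ‖x + y‖ + ‖y‖ := by simpa using norm_sub_le (x + y) y
  have key := h (x + y) y (by linarith [norm_nonneg (x + y)])
  have hcomb : r • (x + y) + s • y = r • x + y := by
    rw [smul_add, add_assoc, ← add_smul, hrs, one_smul]
  rwa [hcomb, add_sub_cancel_right] at key
end

section
/- Let X and Y be real normed spaces, let r, s be nonzero real numbers with r + s = 1, and let d > 0 and δ ≥ 0 be given. Assume that an even mapping f : X → Y satisfies ‖f(rx + sy) + r·s·f(x − y) − r·f(x) − s·f(y)‖ ≤ δ for all x, y ∈ X with ‖x‖ + ‖y‖ ≥ d. Set M := 4d·(1/|r| + |1 − 1/|r||). Then ‖f(2x + y) + 2·f(x) + f(y) − 2·f(x + y) − f(2x)‖ ≤ ((2 + |r| + |s|)/|r·s|)·δ for all x, y ∈ X with ‖x‖ + ‖y‖ ≥ M. -/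
/-- The second difference of an approximate solution `f` of
`f (r x + s y) + r s f (x - y) = r f x + s f y` along `u - v, u, u + v` is controlled as soon as
the approximate equation is available at the four pairs used to interpolate `u + (r - s) v`. -/
theorem norm_second_difference_le {X Y : Type*} [AddCommGroup X] [Module ℝ X]
    [NormedAddCommGroup Y] [NormedSpace ℝ Y]
    {r s δ : ℝ} (hr : r ≠ 0) (hs : s ≠ 0) (hrs : r + s = 1) {f : X → Y} {P : X → X → Prop}
    (h : ∀ x y : X, P x y →
      ‖f (r • x + s • y) + (r * s) • f (x - y) - r • f x - s • f y‖ ≤ δ)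
    {u v : X} (houter : P (u + v) (u - v)) (hinner : P (u + r • v) (u - s • v))
    (hright : P (u + v) u) (hleft : P u (u - v)) :
    ‖f (u + v) + (2 : ℝ) • f v + f (u - v) - (2 : ℝ) • f u - f ((2 : ℝ) • v)‖ ≤
      (2 + |r| + |s|) / |r * s| * δ := by
  have h₁ := h _ _ houter
  have h₂ := h _ _ hinner
  have h₃ := h _ _ hright
  have h₄ := h _ _ hleft
  obtain rfl : s = 1 - r := by linarith
  rw [show r • (u + v) + (1 - r) • (u - v) = u + (2 * r - 1) • v by module,
    show u + v - (u - v) = (2 : ℝ) • v by module] at h₁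
  rw [show r • (u + r • v) + (1 - r) • (u - (1 - r) • v) = u + (2 * r - 1) • v by module,
    show u + r • v - (u - (1 - r) • v) = v by module] at h₂
  rw [show r • (u + v) + (1 - r) • u = u + r • v by module,
    show u + v - u = v by module] at h₃
  rw [show r • u + (1 - r) • (u - v) = u - (1 - r) • v by module,
    show u - (u - v) = v by module] at h₄
  set e₁ := f (u + (2 * r - 1) • v) + (r * (1 - r)) • f ((2 : ℝ) • v) - r • f (u + v) -
    (1 - r) • f (u - v) with he₁
  set e₂ := f (u + (2 * r - 1) • v) + (r * (1 - r)) • f v - r • f (u + r • v) -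
    (1 - r) • f (u - (1 - r) • v) with he₂
  set e₃ := f (u + r • v) + (r * (1 - r)) • f v - r • f (u + v) - (1 - r) • f u with he₃
  set e₄ := f (u - (1 - r) • v) + (r * (1 - r)) • f v - r • f u - (1 - r) • f (u - v) with he₄
  have key : (r * (1 - r)) •
      (f (u + v) + (2 : ℝ) • f v + f (u - v) - (2 : ℝ) • f u - f ((2 : ℝ) • v)) =
      e₂ - e₁ + r • e₃ + (1 - r) • e₄ := by
    rw [he₁, he₂, he₃, he₄]
    module
  have hpos : 0 < |r * (1 - r)| := abs_pos.2 (mul_ne_zero hr hs)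
  rw [div_mul_eq_mul_div, le_div_iff₀ hpos, mul_comm, ← Real.norm_eq_abs (r * (1 - r)),
    ← norm_smul, key]
  calc ‖e₂ - e₁ + r • e₃ + (1 - r) • e₄‖
      ≤ ‖e₂‖ + ‖e₁‖ + ‖r • e₃‖ + ‖(1 - r) • e₄‖ :=
        norm_add_le_of_le (norm_add_le_of_le (norm_sub_le _ _) le_rfl) le_rfl
    _ = ‖e₂‖ + ‖e₁‖ + |r| * ‖e₃‖ + |1 - r| * ‖e₄‖ := by
        rw [norm_smul, norm_smul, Real.norm_eq_abs, Real.norm_eq_abs]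
    _ ≤ δ + δ + |r| * δ + |1 - r| * δ := by gcongr
    _ = (2 + |r| + |1 - r|) * δ := by ring

theorem stmt_17 {X Y : Type*} [NormedAddCommGroup X] [NormedSpace ℝ X]
    [NormedAddCommGroup Y] [NormedSpace ℝ Y]
    (r s d δ : ℝ) (hr : r ≠ 0) (hs : s ≠ 0) (hrs : r + s = 1)
    (hd : 0 < d) (hδ : 0 ≤ δ)
    (f : X → Y) (heven : ∀ x : X, f (-x) = f x)
    (h : ∀ x y : X, d ≤ ‖x‖ + ‖y‖ →
      ‖f (r • x + s • y) + (r * s) • f (x - y) - r • f x - s • f y‖ ≤ δ) :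
    ∀ x y : X, 4 * d * (1 / abs r + abs (1 - 1 / abs r)) ≤ ‖x‖ + ‖y‖ →
      ‖f ((2 : ℝ) • x + y) + (2 : ℝ) • f x + f y -
          (2 : ℝ) • f (x + y) - f ((2 : ℝ) • x)‖ ≤
        (2 + |r| + |s|) / |r * s| * δ := by
  intro x y hxy
  have hM : 4 * d ≤ ‖x‖ + ‖y‖ := by
    refine le_trans (le_mul_of_one_le_right (by positivity) ?_) hxy
    linarith [le_abs_self (1 - 1 / |r|)]
  obtain ⟨u, rfl⟩ : ∃ u, y = u - x := ⟨x + y, by abel⟩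
  have hy : ‖u - x‖ ≤ ‖u‖ + ‖x‖ := norm_sub_le _ _
  have hright : d ≤ ‖u + x‖ + ‖u‖ := by
    have : ‖x‖ ≤ ‖u + x‖ + ‖u‖ := by simpa using norm_sub_le (u + x) u
    linarith [norm_nonneg (u + x)]
  have hleft : d ≤ ‖u‖ + ‖u - x‖ := by
    have : ‖x‖ ≤ ‖u‖ + ‖u - x‖ := by simpa using norm_sub_le u (u - x)
    linarith [norm_nonneg u]
  have houter : d ≤ ‖u + x‖ + ‖u - x‖ := by
    have : ‖(2 : ℝ) • x‖ ≤ ‖u + x‖ + ‖u - x‖ := by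
      rw [show (2 : ℝ) • x = u + x - (u - x) by module]
      exact norm_sub_le _ _
    rw [norm_smul, Real.norm_ofNat] at this
    linarith [norm_nonneg (u + x)]
  rw [show (2 : ℝ) • x + (u - x) = u + x by module, show x + (u - x) = u by abel]
  by_cases hinner : d ≤ ‖u + r • x‖ + ‖u - s • x‖
  · exact norm_second_difference_le (P := fun a b => d ≤ ‖a‖ + ‖b‖) hr hs hrs h
      houter hinner hright hleft
  have hinner' : d ≤ ‖u - r • x‖ + ‖u + s • x‖ := by
    by_contra hlt
    have hx : ‖x‖ ≤ ‖u + r • x‖ + ‖u - s • x‖ := by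
      have hdiff : u + r • x - (u - s • x) = x := by
        rw [add_sub_sub_cancel, ← add_smul, hrs, one_smul]
      simpa only [hdiff] using norm_sub_le (u + r • x) (u - s • x)
    have hu : ∀ w : X, 2 * ‖u‖ ≤ ‖u + w‖ + ‖u - w‖ := fun w => by
      have : ‖(2 : ℝ) • u‖ ≤ ‖u + w‖ + ‖u - w‖ := by
        rw [show (2 : ℝ) • u = u + w + (u - w) by module]
        exact norm_add_le _ _
      rwa [norm_smul, Real.norm_ofNat] at this
    linarith [hu (r • x), hu (s • x)]
  have := norm_second_difference_le (P := fun a b => d ≤ ‖a‖ + ‖b‖) hr hs hrs h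
    (u := u) (v := -x)
    (by rwa [← sub_eq_add_neg, sub_neg_eq_add, add_comm])
    (by rwa [smul_neg, smul_neg, ← sub_eq_add_neg, sub_neg_eq_add])
    (by rwa [← sub_eq_add_neg, add_comm])
    (by rwa [sub_neg_eq_add, add_comm])
  rw [smul_neg, heven, heven, ← sub_eq_add_neg, sub_neg_eq_add] at this
  convert this using 2
  abel
end

section
/- Let X and Y be real normed spaces with X nontrivial, let r, s be nonzero real numbers with r + s = 1, and let d > 0 and δ ≥ 0 be given. Assume that an even mapping f : X → Y satisfies ‖f(rx + sy) + r·s·f(x − y) − r·f(x) − s·f(y)‖ ≤ δ for all x, y ∈ X with ‖x‖ + ‖y‖ ≥ d. Then ‖f(0)‖ ≤ ((2 + |r| + |s|)/|r·s|)·δ, and, with M := 4d·(1/|r| + |1 − 1/|r||), one has ‖4·f(x) − f(2x) − 2·f(0)‖ ≤ ((2 + |r| + |s|)/|r·s|)·δ for all x ∈ X with ‖x‖ ≥ 2M. -/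
theorem stmt_18 {X Y : Type*} [NormedAddCommGroup X] [NormedSpace ℝ X]
    [NormedAddCommGroup Y] [NormedSpace ℝ Y] [Nontrivial X]
    (r s d δ : ℝ) (hr : r ≠ 0) (hs : s ≠ 0) (hrs : r + s = 1)
    (hd : 0 < d) (hδ : 0 ≤ δ)
    (f : X → Y) (heven : ∀ x : X, f (-x) = f x)
    (h : ∀ x y : X, d ≤ ‖x‖ + ‖y‖ →
      ‖f (r • x + s • y) + (r * s) • f (x - y) - r • f x - s • f y‖ ≤ δ) :
    ‖f 0‖ ≤ (2 + |r| + |s|) / |r * s| * δ ∧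
    ∀ x : X, 2 * (4 * d * (1 / abs r + abs (1 - 1 / abs r))) ≤ ‖x‖ →
      ‖(4 : ℝ) • f x - f ((2 : ℝ) • x) - (2 : ℝ) • f 0‖ ≤
        (2 + |r| + |s|) / |r * s| * δ := by
  have hrs0 : 0 < |r * s| := abs_pos.mpr (mul_ne_zero hr hs)
  have hsum : 1 ≤ |r| + |s| := by
    simpa [hrs] using abs_add_le r s
  have key : ∀ v : Y, ‖(r * s) • v‖ ≤ (2 + |r| + |s|) * δ →
      ‖v‖ ≤ (2 + |r| + |s|) / |r * s| * δ := by
    intro v hv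
    rw [norm_smul, Real.norm_eq_abs] at hv
    rw [div_mul_eq_mul_div, le_div_iff₀ hrs0]
    linarith
  refine ⟨?_, fun x hx => ?_⟩
  · obtain ⟨x, hx⟩ := NormedSpace.exists_lt_norm ℝ X d
    have hxx := h x x (by linarith [norm_nonneg x])
    rw [← add_smul, hrs, one_smul, sub_self] at hxx
    have hf : f x + (r * s) • f 0 - r • f x - s • f x = (r * s) • f 0 := by
      obtain rfl : s = 1 - r := by linarith
      module
    rw [hf] at hxx
    apply key
    nlinarith
  · have hdx : d ≤ ‖x‖ := by
      have h1 : 1 ≤ 1 / |r| + abs (1 - 1 / |r|) := by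
        linarith [le_abs_self (1 - 1 / |r|)]
      nlinarith
    have h1 := h (r • x) (-(s • x)) (by
      rw [norm_neg, norm_smul, norm_smul, Real.norm_eq_abs, Real.norm_eq_abs]
      nlinarith)
    have h2 := h x (-x) (by linarith [norm_nonneg (-x)])
    have h3 := h x 0 (by simpa using hdx)
    have h4 := h 0 (-x) (by simpa using hdx)
    have e1 : r • r • x + s • -(s • x) = r • x + s • -x := by
      obtain rfl : s = 1 - r := by linarith
      module
    have e2 : r • x - -(s • x) = x := by
      obtain rfl : s = 1 - r := by linarith
      module
    have e3 : x - -x = (2 : ℝ) • x := by module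
    rw [e1, e2, heven (s • x)] at h1
    rw [e3, heven x] at h2
    rw [smul_zero, add_zero, sub_zero] at h3
    rw [smul_zero, zero_add, zero_sub, neg_neg, smul_neg, heven (s • x), heven x] at h4
    apply key
    set w := f (r • x + s • -x)
    have identity : (r * s) • ((4 : ℝ) • f x - f ((2 : ℝ) • x) - (2 : ℝ) • f 0) =
        (w + (r * s) • f x - r • f (r • x) - s • f (s • x)) -
        (w + (r * s) • f ((2 : ℝ) • x) - r • f x - s • f x) +
        r • (f (r • x) + (r * s) • f x - r • f x - s • f 0) +
        s • (f (s • x) + (r * s) • f x - r • f 0 - s • f x) := by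
      generalize f (r • x) = p
      generalize f (s • x) = q
      obtain rfl : s = 1 - r := by linarith
      module
    rw [identity]
    have h3' := mul_le_mul_of_nonneg_left h3 (abs_nonneg r)
    have h4' := mul_le_mul_of_nonneg_left h4 (abs_nonneg s)
    rw [← Real.norm_eq_abs, ← norm_smul] at h3' h4'
    rw [Real.norm_eq_abs] at h3' h4'
    refine (norm_add₃_le.trans (add_le_add_left (add_le_add_left (norm_sub_le _ _) _) _)).trans ?_
    linarith
end

section
/- Let X be a real normed linear space containing a vector of norm 1, let p, q, u, v be nonzero real numbers, let r be a real number with 0 < r < 1, and set s = 1 − r. If ‖rx + sy‖^p + r·s·‖x − y‖^q = r·‖x‖^u + s·‖y‖^v holds for all x, y ∈ X, then p = 2. -/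
theorem stmt_19 {X : Type*} [NormedAddCommGroup X] [NormedSpace ℝ X]
    (hX : ∃ x : X, ‖x‖ = 1)
    (p q u v : ℝ) (hp : p ≠ 0) (hq : q ≠ 0) (hu : u ≠ 0) (hv : v ≠ 0)
    (r : ℝ) (hr0 : 0 < r) (hr1 : r < 1)
    (h : ∀ x y : X,
      ‖r • x + (1 - r) • y‖ ^ p + r * (1 - r) * ‖x - y‖ ^ q =
        r * ‖x‖ ^ u + (1 - r) * ‖y‖ ^ v) :
    p = 2 := by
  obtain ⟨x, hx⟩ := hX
  have h_eq := h x 0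
  simp only [smul_zero, add_zero, sub_zero, norm_smul, hx, norm_zero, Real.zero_rpow hv,
    Real.one_rpow, Real.norm_of_nonneg hr0.le, mul_one, mul_zero] at h_eq
  have h_pow : r ^ p = r ^ (2 : ℝ) := by
    rw [Real.rpow_two]
    linarith
  exact (Real.rpow_right_inj hr0 hr1.ne).mp h_pow
end
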